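/- Let g : ℝ² → ℝ be continuously differentiable and let x₀ ∈ ℝ² be such that ∇g(x) ≠ 0 for every x with g(x) = g(x₀). If z, ẑ : I → ℝ² are two functions on an interval I containing 0 that both satisfy the Hamiltonian system z₁′(t) = −∂g/∂x₂(z(t)), z₂′(t) = ∂g/∂x₁(z(t)) on I with z(0) = ẑ(0) = x₀, then z(t) = ẑ(t) for all t ∈ I (uniqueness of the solution due to the Hamiltonian structure). -/

import Mathlib

open Set Filter Topology in
/-- Near a point where `(g, ℓ)` is a local chart and `X` is transverse to the fibres of `ℓ`, there
is a coordinate on the level set of `g` which grows with unit speed along `X`. -/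
theorem exists_unit_speed_coordinate {E : Type*} [NormedAddCommGroup E] [NormedSpace ℝ E]
    [CompleteSpace E] {X : E → E} (hX : Continuous X) {g : E → ℝ} {ℓ : E →L[ℝ] ℝ}
    {A : E ≃L[ℝ] ℝ × ℝ} {p : E}
    (h : HasStrictFDerivAt (fun x => (g x, ℓ x)) (A : E →L[ℝ] ℝ × ℝ) p) (hp : ℓ (X p) ≠ 0) :
    ∃ U ∈ 𝓝 p, ∃ F k : ℝ → ℝ, (∀ s, HasDerivAt F (k s) s) ∧ Function.Injective F ∧
      (∀ x ∈ U, g x = g p → k (ℓ x) * ℓ (X x) = 1) ∧ InjOn (fun x => (g x, ℓ x)) U := by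
  set e := h.toOpenPartialHomeomorph
  have hpe : p ∈ e.source := h.mem_toOpenPartialHomeomorph_source
  have htarget : (g p, ℓ p) ∈ e.target := e.map_source hpe
  have hpair : Continuous fun s : ℝ => (g p, s) := by fun_prop
  let f : ℝ → ℝ := fun s => ℓ (X (e.symm (g p, s)))
  have hf : ∀ s, (g p, s) ∈ e.target → ContinuousAt f s := fun s hs =>
    (ℓ.continuous.comp hX).continuousAt.comp
      (ContinuousAt.comp (f := fun s : ℝ => (g p, s)) (e.continuousAt_symm hs)
        hpair.continuousAt)
  have hfp : f (ℓ p) ≠ 0 := by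
    have : e.symm (g p, ℓ p) = p := e.left_inv hpe
    simpa [f, this] using hp
  have hS : ∀ᶠ s in 𝓝 (ℓ p), (g p, s) ∈ e.target ∧ f s ≠ 0 :=
    (hpair.continuousAt.eventually (e.open_target.mem_nhds htarget)).and
      ((hf _ htarget).eventually_ne hfp)
  obtain ⟨δ, hδ, hball⟩ := Metric.nhds_basis_closedBall.mem_iff.1 hS
  rw [Real.closedBall_eq_Icc] at hball
  have hle : ℓ p - δ ≤ ℓ p + δ := by linarith
  let k : ℝ → ℝ := IccExtend hle fun s => (f s)⁻¹
  have hk : Continuous k := by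
    refine Continuous.Icc_extend' (continuous_iff_continuousAt.2 fun s => ?_)
    exact ((hf _ (hball s.2).1).comp continuousAt_subtype_val).inv₀ (hball s.2).2
  have hk0 : ∀ s, k s ≠ 0 := fun s => inv_ne_zero (hball (projIcc _ _ hle s).2).2
  have hF : ∀ s, HasDerivAt (fun y => ∫ x in (0 : ℝ)..y, k x) (k s) s := fun s =>
    (hk.integral_hasStrictDerivAt 0 s).hasDerivAt
  refine ⟨e.source ∩ ℓ ⁻¹' Icc (ℓ p - δ) (ℓ p + δ),
    inter_mem (e.open_source.mem_nhds hpe) (ℓ.continuous.continuousAt.preimage_mem_nhds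
      (Icc_mem_nhds (by linarith) (by linarith))), _, k, hF, ?_, ?_,
    fun x hx y hy hxy => e.injOn hx.1 hy.1 hxy⟩
  · refine Function.Injective.of_lt_imp_ne fun x y hxy heq => ?_
    obtain ⟨c, -, hc⟩ := exists_hasDerivAt_eq_zero hxy
      (fun s _ => (hF s).continuousAt.continuousWithinAt) heq fun s _ => hF s
    exact hk0 c hc
  · rintro x ⟨hxe, hx⟩ hgx
    have hkx : k (ℓ x) = (f (ℓ x))⁻¹ := IccExtend_of_mem hle _ hx
    have hsymm : e.symm (g p, ℓ x) = x := by rw [← hgx]; exact e.left_inv hxe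
    have hfx : f (ℓ x) = ℓ (X x) := by simp only [f, hsymm]
    rw [hkx, hfx, inv_mul_cancel₀]
    exact hfx ▸ (hball hx).2

theorem Convex.eq_of_hasDerivAt_eq_zero {s : Set ℝ} (hs : Convex ℝ s) {f : ℝ → ℝ}
    (hf : ∀ t ∈ s, HasDerivAt f 0 t) {a b : ℝ} (ha : a ∈ s) (hb : b ∈ s) : f a = f b := by
  have := hs.norm_image_sub_le_of_norm_hasDerivWithin_le (C := 0)
    (fun t ht => (hf t ht).hasDerivWithinAt) (by simp) hb ha
  simpa [sub_eq_zero] using this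

theorem ContinuousLinearMap.apply_prod_eq (L : ℝ × ℝ →L[ℝ] ℝ) (v : ℝ × ℝ) :
    L v = v.1 * L (1, 0) + v.2 * L (0, 1) := by
  have : v = v.1 • ((1, 0) : ℝ × ℝ) + v.2 • ((0, 1) : ℝ × ℝ) := by ext <;> simp
  conv_lhs => rw [this]
  simp only [map_add, map_smul, smul_eq_mul]

/-- The Hamiltonian vector field of `g`. -/
noncomputable def hamiltonianField (g : ℝ × ℝ → ℝ) (x : ℝ × ℝ) : ℝ × ℝ :=
  (-(fderiv ℝ g x (0, 1)), fderiv ℝ g x (1, 0))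

theorem continuous_hamiltonianField {g : ℝ × ℝ → ℝ} (hg : ContDiff ℝ 1 g) :
    Continuous (hamiltonianField g) := by
  have := hg.continuous_fderiv one_ne_zero
  unfold hamiltonianField
  fun_prop

theorem fderiv_hamiltonianField (g : ℝ × ℝ → ℝ) (x : ℝ × ℝ) :
    fderiv ℝ g x (hamiltonianField g x) = 0 := by
  rw [ContinuousLinearMap.apply_prod_eq, hamiltonianField]
  ring

theorem exists_chart_of_fderiv_ne_zero {g : ℝ × ℝ → ℝ} (hg : ContDiff ℝ 1 g) {p : ℝ × ℝ}
    (hp : fderiv ℝ g p ≠ 0) :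
    ∃ (ℓ : ℝ × ℝ →L[ℝ] ℝ) (A : (ℝ × ℝ) ≃L[ℝ] ℝ × ℝ),
      HasStrictFDerivAt (fun x => (g x, ℓ x)) (A : ℝ × ℝ →L[ℝ] ℝ × ℝ) p ∧
        ℓ (hamiltonianField g p) ≠ 0 := by
  set L := fderiv ℝ g p with hL
  set u := L (1, 0) with hu
  set v := L (0, 1) with hv
  have hLx : ∀ x, L x = x.1 * u + x.2 * v := L.apply_prod_eq
  have hpos : u ^ 2 + v ^ 2 ≠ 0 := by
    intro h0
    have hu0 : u = 0 := by nlinarith [sq_nonneg u, sq_nonneg v]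
    have hv0 : v = 0 := by nlinarith [sq_nonneg u, sq_nonneg v]
    exact hp (ContinuousLinearMap.ext fun x => by simp [hLx, hu0, hv0])
  let ℓ : ℝ × ℝ →L[ℝ] ℝ :=
    u • ContinuousLinearMap.snd ℝ ℝ ℝ - v • ContinuousLinearMap.fst ℝ ℝ ℝ
  have hℓ : ∀ x, ℓ x = u * x.2 - v * x.1 := fun x => by simp [ℓ]
  have hinj : Function.Injective (L.prod ℓ : ℝ × ℝ →ₗ[ℝ] ℝ × ℝ) := by
    refine (injective_iff_map_eq_zero _).2 fun x hx => ?_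
    have h1 : x.1 * u + x.2 * v = 0 := by rw [← hLx]; exact congrArg Prod.fst hx
    have h2 : u * x.2 - v * x.1 = 0 := by rw [← hℓ]; exact congrArg Prod.snd hx
    have h3 : (u ^ 2 + v ^ 2) * x.1 = 0 := by linear_combination u * h1 - v * h2
    have h4 : (u ^ 2 + v ^ 2) * x.2 = 0 := by linear_combination v * h1 + u * h2
    exact Prod.ext ((mul_eq_zero.1 h3).resolve_left hpos) ((mul_eq_zero.1 h4).resolve_left hpos)
  refine ⟨ℓ, (LinearEquiv.ofInjectiveEndo _ hinj).toContinuousLinearEquiv, ?_, ?_⟩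
  · exact (hg.contDiffAt.hasStrictFDerivAt one_ne_zero).prodMk ℓ.hasStrictFDerivAt
  · have : ℓ (hamiltonianField g p) = u ^ 2 + v ^ 2 := by
      rw [hℓ]
      simp only [hamiltonianField, ← hL, ← hu, ← hv]
      ring
    rwa [this]

open Set Filter Topology in
theorem hamiltonian_eventuallyEq {g : ℝ × ℝ → ℝ} (hg : ContDiff ℝ 1 g) {I : Set ℝ}
    (hI : Convex ℝ I) {za zb : ℝ → ℝ × ℝ}
    (hza : ∀ t ∈ I, HasDerivAt za (hamiltonianField g (za t)) t)
    (hzb : ∀ t ∈ I, HasDerivAt zb (hamiltonianField g (zb t)) t)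
    {t₀ : ℝ} (ht₀ : t₀ ∈ I) (heq : za t₀ = zb t₀) (hp : fderiv ℝ g (za t₀) ≠ 0)
    (hga : ∀ t ∈ I, g (za t) = g (za t₀)) (hgb : ∀ t ∈ I, g (zb t) = g (za t₀)) :
    ∀ᶠ t in 𝓝[I] t₀, za t = zb t := by
  obtain ⟨ℓ, A, hA, hℓ⟩ := exists_chart_of_fderiv_ne_zero hg hp
  obtain ⟨U, hU, F, k, hF, hFinj, hk, hUinj⟩ :=
    exists_unit_speed_coordinate (continuous_hamiltonianField hg) hA hℓ
  have hUa : ∀ᶠ t in 𝓝 t₀, za t ∈ U := (hza _ ht₀).continuousAt.eventually_mem hU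
  have hUb : ∀ᶠ t in 𝓝 t₀, zb t ∈ U :=
    (hzb _ ht₀).continuousAt.eventually_mem (heq ▸ hU)
  obtain ⟨δ, hδ, hball⟩ := Metric.nhds_basis_ball.mem_iff.1 (hUa.and hUb)
  have hunit : ∀ z : ℝ → ℝ × ℝ, ∀ t, HasDerivAt z (hamiltonianField g (z t)) t → z t ∈ U →
      g (z t) = g (za t₀) → HasDerivAt (fun t => F (ℓ (z t))) 1 t := by
    intro z t hz hzU hgz
    rw [← hk _ hzU hgz]
    exact (hF _).comp t (ℓ.hasFDerivAt.comp_hasDerivAt t hz)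
  filter_upwards [self_mem_nhdsWithin, mem_nhdsWithin_of_mem_nhds (Metric.ball_mem_nhds t₀ hδ)]
    with t htI htδ
  have hconst := (hI.inter (convex_ball t₀ δ)).eq_of_hasDerivAt_eq_zero
    (f := fun t => F (ℓ (za t)) - F (ℓ (zb t)))
    (fun s hs => by
      simpa using (hunit za s (hza s hs.1) (hball hs.2).1 (hga s hs.1)).fun_sub
        (hunit zb s (hzb s hs.1) (hball hs.2).2 (hgb s hs.1)))
    ⟨htI, htδ⟩ ⟨ht₀, Metric.mem_ball_self hδ⟩
  simp only [heq, sub_self, sub_eq_zero] at hconst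
  exact hUinj (hball htδ).1 (hball htδ).2
    (Prod.ext ((hga t htI).trans (hgb t htI).symm) (hFinj hconst))

/-- Uniqueness of solutions of the Hamiltonian system through a
point `x₀` whose level set carries no critical point of `g`. -/
theorem hamiltonian_uniqueness
    (g : ℝ × ℝ → ℝ) (hg : ContDiff ℝ 1 g) (x₀ : ℝ × ℝ)
    (hgrad : ∀ x : ℝ × ℝ, g x = g x₀ → fderiv ℝ g x ≠ 0)
    (I : Set ℝ) (hI : Convex ℝ I) (h0 : (0 : ℝ) ∈ I)
    (za zb : ℝ → ℝ × ℝ)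
    (hza : ∀ t ∈ I, HasDerivAt za (-(fderiv ℝ g (za t) (0, 1)), fderiv ℝ g (za t) (1, 0)) t)
    (hzb : ∀ t ∈ I, HasDerivAt zb (-(fderiv ℝ g (zb t) (0, 1)), fderiv ℝ g (zb t) (1, 0)) t)
    (hza0 : za 0 = x₀) (hzb0 : zb 0 = x₀) :
    ∀ t ∈ I, za t = zb t := by
  have hconserved : ∀ z : ℝ → ℝ × ℝ, (∀ t ∈ I, HasDerivAt z (hamiltonianField g (z t)) t) →
      z 0 = x₀ → ∀ t ∈ I, g (z t) = g x₀ := by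
    intro z hz hz0 t ht
    rw [← hz0]
    refine hI.eq_of_hasDerivAt_eq_zero (f := fun t => g (z t)) (fun s hs => ?_) ht h0
    rw [← fderiv_hamiltonianField g (z s)]
    exact ((hg.differentiable one_ne_zero) _).hasFDerivAt.comp_hasDerivAt s (hz s hs)
  have hga := hconserved za hza hza0
  have hgb := hconserved zb hzb hzb0
  have hca : ContinuousOn za I := fun t ht => (hza t ht).continuousAt.continuousWithinAt
  have hcb : ContinuousOn zb I := fun t ht => (hzb t ht).continuousAt.continuousWithinAt
  have : PreconnectedSpace I := Subtype.preconnectedSpace hI.isPreconnected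
  have hclopen : IsClopen {t : I | za t = zb t} := by
    refine ⟨isClosed_eq hca.domRestrict hcb.domRestrict, isOpen_iff_mem_nhds.2 fun t ht => ?_⟩
    rw [nhds_subtype_eq_comap_nhdsWithin]
    exact Filter.preimage_mem_comap (hamiltonian_eventuallyEq hg hI hza hzb t.2 ht
      (hgrad _ (hga t t.2)) (fun s hs => (hga s hs).trans (hga t t.2).symm)
      fun s hs => (hgb s hs).trans (hga t t.2).symm)
  have huniv := hclopen.eq_univ ⟨⟨0, h0⟩, hza0.trans hzb0.symm⟩
  exact fun t ht => huniv.ge (Set.mem_univ (⟨t, ht⟩ : I))
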